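/- For all integers m ≥ 3 and n ≥ 0, with N = 2(3^{m−1} + 2n − 1): every 2-element subset of ℤ/Nℤ that occurs as an edge of some face F_i occurs as an edge of exactly two of the faces F_j (j ∈ ℤ/Nℤ); consequently the total number of distinct 2-element subsets occurring as edges of faces equals (3^{m−1} + 2n − 1)(2m − 1), and the Euler characteristic f_0 − f_1 + f_2 — where f_0 = N is the number of vertices, f_1 is the number of distinct edges, and f_2 = N is the number of faces — equals (3^{m−1} + 2n − 1)(5 − 2m). -/

import Mathlib

/-- The sequence `b` : `b (2l-1) = 3^(l-1) - 1`, `b (2l) = 2·3^(l-1) - 1` (for `k ≥ 1`). -/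
def bseq (k : ℕ) : ℤ := if k % 2 = 1 then 3 ^ (k / 2) - 1 else 2 * 3 ^ (k / 2 - 1) - 1

/-- Offsets of the face `F_i` in the odd case `M_{2m-1, 2(3^{m-1}+2n-1)}`. -/
def oddOff (m n k : ℕ) : ℤ :=
  bseq k + (if k = 2 * m - 2 then (n : ℤ) else if k = 2 * m - 1 then 2 * (n : ℤ) else 0)

/-- The entries of the face `F_i` (odd case). -/
def Fface (m n : ℕ) (i : ZMod (2 * (3 ^ (m - 1) + 2 * n - 1))) :
    Fin (2 * m - 1) → ZMod (2 * (3 ^ (m - 1) + 2 * n - 1)) :=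
  fun j => i + (oddOff m n (j.1 + 1) : ZMod (2 * (3 ^ (m - 1) + 2 * n - 1)))

/-- `e` is an edge of the face `F_j`: a set of two cyclically consecutive entries. -/
def IsFedge (m n : ℕ) (j : ZMod (2 * (3 ^ (m - 1) + 2 * n - 1)))
    (e : Set (ZMod (2 * (3 ^ (m - 1) + 2 * n - 1)))) : Prop :=
  ∃ t : Fin (2 * m - 1), e = {Fface m n j t, Fface m n j (finRotate (2 * m - 1) t)}

/-- The common difference of the steps `2l` and `2l+1` around a face. -/
def stepLen (m n l : ℕ) : ℕ :=
  if l + 2 < m then 3 ^ l else if l + 2 = m then 3 ^ l + n else 3 ^ (m - 1) + 2 * n - 1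

/-- The other position at which an edge in position `t` occurs. -/
def partner (m t : ℕ) : ℕ :=
  if t = 2 * m - 2 then t else if t % 2 = 0 then t + 1 else t - 1

/-- The difference between the indices of the two faces that share an edge in position `t`. -/
def partnerShift (m n t : ℕ) : ZMod (2 * (3 ^ (m - 1) + 2 * n - 1)) :=
  if t % 2 = 0 then -(stepLen m n (t / 2) : ZMod _) else (stepLen m n (t / 2) : ZMod _)

theorem bseq_odd (l : ℕ) : bseq (2 * l + 1) = 3 ^ l - 1 := by
  have h1 : (2 * l + 1) % 2 = 1 := by omega
  have h2 : (2 * l + 1) / 2 = l := by omega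
  simp [bseq, h1, h2]

theorem bseq_even (l : ℕ) : bseq (2 * l + 2) = 2 * 3 ^ l - 1 := by
  have h1 : (2 * l + 2) % 2 = 0 := by omega
  simp [bseq, h1]

theorem oddOff_one {m n : ℕ} (hm : 3 ≤ m) : oddOff m n 1 = 0 := by
  have h1 : 1 ≠ 2 * m - 2 := by omega
  have h2 : 1 ≠ 2 * m - 1 := by omega
  simp [oddOff, bseq, h1, h2]

theorem oddOff_last {m n : ℕ} (hm : 3 ≤ m) :
    oddOff m n (2 * m - 1) = ((3 ^ (m - 1) + 2 * n - 1 : ℕ) : ℤ) := by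
  obtain ⟨p, rfl⟩ := Nat.exists_eq_add_of_le' hm
  have h0 : 1 ≤ 3 ^ (p + 2) := Nat.one_le_pow _ _ (by norm_num)
  have h1 : 2 * (p + 3) - 1 = 2 * (p + 2) + 1 := by omega
  rw [oddOff, if_neg (by omega), if_pos rfl, h1, bseq_odd, show p + 3 - 1 = p + 2 by omega,
    Nat.cast_sub (by omega)]
  push_cast
  ring

theorem oddOff_succ {m n t : ℕ} (ht : t + 2 < 2 * m) :
    oddOff m n (t + 2) = oddOff m n (t + 1) + stepLen m n (t / 2) := by
  rcases Nat.even_or_odd' t with ⟨l, rfl | rfl⟩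
  · rw [oddOff, oddOff, bseq_odd, bseq_even, stepLen, show 2 * l / 2 = l by omega]
    split_ifs <;> first | omega | (push_cast; ring)
  · rw [oddOff, oddOff, show 2 * l + 1 + 2 = 2 * (l + 1) + 1 by ring, bseq_odd,
      show 2 * l + 1 + 1 = 2 * l + 2 by ring, bseq_even, stepLen,
      show (2 * l + 1) / 2 = l by omega]
    split_ifs <;> first | omega | (push_cast; ring)

theorem stepLen_pos {m n l : ℕ} (hm : 3 ≤ m) : 0 < stepLen m n l := by
  have h1 : 3 ^ 2 ≤ 3 ^ (m - 1) := Nat.pow_le_pow_right (by norm_num) (by omega)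
  have h2 : 0 < 3 ^ l := by positivity
  rw [stepLen]
  split_ifs <;> omega

theorem stepLen_lt {m n l k : ℕ} (hlk : l < k) (hk : k < m) : stepLen m n l < stepLen m n k := by
  have h1 : 3 ^ (l + 1) ≤ 3 ^ k := Nat.pow_le_pow_right (by norm_num) hlk
  have h2 : 3 ^ k ≤ 3 ^ (m - 1) := Nat.pow_le_pow_right (by norm_num) (by omega)
  have h3 : 0 < 3 ^ l := by positivity
  rw [pow_succ] at h1
  rw [stepLen, stepLen]
  split_ifs <;> omega

theorem stepLen_last {m n : ℕ} (hm : 3 ≤ m) :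
    stepLen m n (m - 1) = 3 ^ (m - 1) + 2 * n - 1 := by
  rw [stepLen, if_neg (by omega), if_neg (by omega)]

theorem stepLen_le {m n l : ℕ} (hm : 3 ≤ m) (hl : l < m) :
    stepLen m n l ≤ 3 ^ (m - 1) + 2 * n - 1 := by
  rw [← stepLen_last hm]
  rcases (show l ≤ m - 1 by omega).eq_or_lt with rfl | h
  · rfl
  · exact (stepLen_lt h (by omega)).le

theorem stepLen_inj {m n l k : ℕ} (hl : l < m) (hk : k < m)
    (h : stepLen m n l = stepLen m n k) : l = k := by
  rcases lt_trichotomy l k with hlk | rfl | hlk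
  · exact absurd h (stepLen_lt hlk hk).ne
  · rfl
  · exact absurd h (stepLen_lt hlk hl).ne'

theorem pair_eq_pair_zmod {D a b : ℕ} (ha : 0 < a) (hb : 0 < b) (haD : a ≤ D) (hbD : b ≤ D)
    (x y : ZMod (2 * D)) :
    ({x, x + a} : Set (ZMod (2 * D))) = {y, y + b} ↔
      a = b ∧ (x = y ∨ a = D ∧ x = y + b) := by
  have hDD : (D : ZMod (2 * D)) + D = 0 := by
    have := ZMod.natCast_self (2 * D)
    push_cast at this
    rw [← two_mul, this]
  rw [Set.pair_eq_pair_iff]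
  constructor
  · rintro (⟨rfl, h⟩ | ⟨rfl, h⟩)
    · have h := (ZMod.natCast_eq_natCast_iff' _ _ _).1 (add_left_cancel h)
      rw [Nat.mod_eq_of_lt (by omega), Nat.mod_eq_of_lt (by omega)] at h
      exact ⟨h, .inl rfl⟩
    · have h : ((b + a : ℕ) : ZMod (2 * D)) = 0 := by
        push_cast
        rwa [add_assoc, add_eq_left] at h
      have := Nat.le_of_dvd (by omega) ((ZMod.natCast_eq_zero_iff _ _).1 h)
      exact ⟨by omega, .inr ⟨by omega, rfl⟩⟩
  · rintro ⟨rfl, rfl | ⟨rfl, rfl⟩⟩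
    · exact .inl ⟨rfl, rfl⟩
    · exact .inr ⟨rfl, by rw [add_assoc, hDD, add_zero]⟩

theorem Fface_finRotate {m n : ℕ} (hm : 3 ≤ m) (j : ZMod (2 * (3 ^ (m - 1) + 2 * n - 1)))
    (t : Fin (2 * m - 1)) :
    Fface m n j (finRotate (2 * m - 1) t) = Fface m n j t + (stepLen m n (t / 2) : ℕ) := by
  obtain ⟨k, hk⟩ : ∃ k, 2 * m - 1 = k + 1 := ⟨2 * m - 2, by omega⟩
  have hv : ((finRotate (2 * m - 1) t : Fin (2 * m - 1)) : ℕ) =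
      if t.val = 2 * m - 2 then 0 else t.val + 1 := by
    have key : ∀ q (hq : q = k + 1) (t : Fin q), ((finRotate q t : Fin q) : ℕ) =
        if t.val = k then 0 else t.val + 1 := by
      rintro q rfl t
      rw [coe_finRotate]
      simp only [Fin.ext_iff, Fin.val_last]
    rw [key _ hk, show k = 2 * m - 2 by omega]
  have ht := t.2
  rw [Fface, Fface, hv, add_assoc]
  congr 1
  split_ifs with h
  · rw [h, show 2 * m - 2 + 1 = 2 * m - 1 by omega, show (2 * m - 2) / 2 = m - 1 by omega,
      zero_add, oddOff_one hm, oddOff_last hm, stepLen_last hm, Int.cast_natCast, ← Nat.cast_add,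
      ← two_mul, ZMod.natCast_self, Int.cast_zero]
  · rw [oddOff_succ (by omega)]
    push_cast
    rfl

theorem partner_lt {m t : ℕ} (ht : t < 2 * m - 1) : partner m t < 2 * m - 1 := by
  rw [partner]
  split_ifs <;> omega

theorem partnerShift_ne_zero {m n t : ℕ} (hm : 3 ≤ m) (ht : t < 2 * m - 1) :
    partnerShift m n t ≠ 0 := by
  have h : ((stepLen m n (t / 2) : ℕ) : ZMod (2 * (3 ^ (m - 1) + 2 * n - 1))) ≠ 0 := by
    rw [Ne, ZMod.natCast_eq_zero_iff]
    intro h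
    have h1 := stepLen_pos (n := n) (l := t / 2) hm
    have h2 := stepLen_le (n := n) (l := t / 2) hm (by omega)
    have := Nat.le_of_dvd h1 h
    omega
  rw [partnerShift]
  split_ifs
  · exact neg_ne_zero.2 h
  · exact h

/-- The edge of `F_j` that starts at the entry in position `t`. -/
def faceEdge (m n : ℕ) (p : ZMod (2 * (3 ^ (m - 1) + 2 * n - 1)) × Fin (2 * m - 1)) :
    Set (ZMod (2 * (3 ^ (m - 1) + 2 * n - 1))) :=
  {Fface m n p.1 p.2, Fface m n p.1 (finRotate (2 * m - 1) p.2)}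

theorem faceEdge_eq_iff {m n : ℕ} (hm : 3 ≤ m)
    (p q : ZMod (2 * (3 ^ (m - 1) + 2 * n - 1)) × Fin (2 * m - 1)) :
    faceEdge m n q = faceEdge m n p ↔
      q = p ∨ q = (p.1 + partnerShift m n p.2, ⟨partner m p.2, partner_lt p.2.2⟩) := by
  obtain ⟨j, t, ht⟩ := p
  obtain ⟨i, s, hs⟩ := q
  simp only [faceEdge, Fface_finRotate hm, Prod.mk.injEq, Fin.mk.injEq]
  rw [pair_eq_pair_zmod (stepLen_pos hm) (stepLen_pos hm) (stepLen_le hm (by omega))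
    (stepLen_le hm (by omega))]
  have e1 : stepLen m n (s / 2) = stepLen m n (t / 2) ↔ s / 2 = t / 2 :=
    ⟨stepLen_inj (by omega) (by omega), fun h => by rw [h]⟩
  have e2 : stepLen m n (s / 2) = 3 ^ (m - 1) + 2 * n - 1 ↔ s = 2 * m - 2 := by
    rw [← stepLen_last hm]
    refine ⟨fun h => ?_, fun h => by rw [h, show (2 * m - 2) / 2 = m - 1 by omega]⟩
    have := stepLen_inj (by omega) (by omega) h
    omega
  rw [e1, e2]
  simp only [Fface, partner, partnerShift]
  by_cases htm : t = 2 * m - 2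
  · subst htm
    have e : s / 2 = (2 * m - 2) / 2 ↔ s = 2 * m - 2 := by omega
    have hD : -((stepLen m n ((2 * m - 2) / 2) : ℕ) : ZMod (2 * (3 ^ (m - 1) + 2 * n - 1))) =
        (stepLen m n ((2 * m - 2) / 2) : ℕ) := by
      rw [show (2 * m - 2) / 2 = m - 1 by omega, stepLen_last hm, neg_eq_iff_add_eq_zero,
        ← Nat.cast_add, ← two_mul, ZMod.natCast_self]
    rw [e, if_pos rfl, if_pos (by omega), hD]
    constructor
    · rintro ⟨rfl, h | ⟨-, h⟩⟩
      · exact .inl ⟨add_right_cancel h, rfl⟩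
      · exact .inr ⟨by linear_combination h, rfl⟩
    · rintro (⟨rfl, rfl⟩ | ⟨rfl, rfl⟩)
      · exact ⟨rfl, .inl rfl⟩
      · exact ⟨rfl, .inr ⟨rfl, by ring⟩⟩
  · rw [if_neg htm]
    have hne : ¬ (s / 2 = t / 2 ∧ s = 2 * m - 2) := by omega
    have drop (P Q R S : Prop) (h : ¬ (P ∧ Q)) : P ∧ (R ∨ Q ∧ S) ↔ P ∧ R := by tauto
    rw [drop _ _ _ _ hne]
    by_cases hpar : t % 2 = 0
    · have e : s / 2 = t / 2 ↔ s = t ∨ s = t + 1 := by omega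
      have ho := congrArg (Int.cast : ℤ → ZMod (2 * (3 ^ (m - 1) + 2 * n - 1)))
        (oddOff_succ (m := m) (n := n) (t := t) (by omega))
      push_cast at ho
      rw [e, if_pos hpar, if_pos hpar]
      constructor
      · rintro ⟨rfl | rfl, h⟩
        · exact .inl ⟨add_right_cancel h, rfl⟩
        · exact .inr ⟨by linear_combination h - ho, rfl⟩
      · rintro (⟨rfl, rfl⟩ | ⟨rfl, rfl⟩)
        · exact ⟨.inl rfl, rfl⟩
        · exact ⟨.inr rfl, by linear_combination ho⟩
    · obtain ⟨r, rfl⟩ : ∃ r, t = r + 1 := ⟨t - 1, by omega⟩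
      have e : s / 2 = (r + 1) / 2 ↔ s = r + 1 ∨ s = r := by omega
      have ho := congrArg (Int.cast : ℤ → ZMod (2 * (3 ^ (m - 1) + 2 * n - 1)))
        (oddOff_succ (m := m) (n := n) (t := r) (by omega))
      push_cast at ho
      rw [e, if_neg hpar, if_neg hpar, show (r + 1) / 2 = r / 2 by omega]
      constructor
      · rintro ⟨rfl | rfl, h⟩
        · exact .inl ⟨add_right_cancel h, rfl⟩
        · exact .inr ⟨by linear_combination h + ho, rfl⟩
      · rintro (⟨rfl, rfl⟩ | ⟨rfl, rfl⟩)
        · exact ⟨.inl rfl, rfl⟩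
        · exact ⟨.inr rfl, by linear_combination -ho⟩

theorem isFedge_faceEdge_iff {m n : ℕ} (hm : 3 ≤ m)
    (p : ZMod (2 * (3 ^ (m - 1) + 2 * n - 1)) × Fin (2 * m - 1))
    (i : ZMod (2 * (3 ^ (m - 1) + 2 * n - 1))) :
    IsFedge m n i (faceEdge m n p) ↔ i = p.1 ∨ i = p.1 + partnerShift m n p.2 := by
  have h : IsFedge m n i (faceEdge m n p) ↔ ∃ t, faceEdge m n (i, t) = faceEdge m n p :=
    exists_congr fun _ => eq_comm
  simp only [h, faceEdge_eq_iff hm, Prod.ext_iff, exists_or, exists_and_left, exists_eq, and_true]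

theorem card_isFedge {m n : ℕ} (hm : 3 ≤ m) (e : Set (ZMod (2 * (3 ^ (m - 1) + 2 * n - 1))))
    (he : ∃ j, IsFedge m n j e) :
    Nat.card {j : ZMod (2 * (3 ^ (m - 1) + 2 * n - 1)) // IsFedge m n j e} = 2 := by
  obtain ⟨j, t, rfl⟩ := he
  have hset : {i | IsFedge m n i (faceEdge m n (j, t))} = {j, j + partnerShift m n t} := by
    ext i
    exact isFedge_faceEdge_iff hm (j, t) i
  change Nat.card ({i | IsFedge m n i (faceEdge m n (j, t))} : Set _) = 2
  rw [hset, Nat.card_coe_set_eq, Set.ncard_pair]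
  simpa using partnerShift_ne_zero hm t.2

theorem two_mul_card_edges {m n : ℕ} (hm : 3 ≤ m) :
    2 * Nat.card {e : Set (ZMod (2 * (3 ^ (m - 1) + 2 * n - 1))) // ∃ j, IsFedge m n j e} =
      2 * (3 ^ (m - 1) + 2 * n - 1) * (2 * m - 1) := by
  have hpow : 3 ^ 2 ≤ 3 ^ (m - 1) := Nat.pow_le_pow_right (by norm_num) (by omega)
  have : NeZero (2 * (3 ^ (m - 1) + 2 * n - 1)) := ⟨by omega⟩
  let f : ZMod (2 * (3 ^ (m - 1) + 2 * n - 1)) × Fin (2 * m - 1) →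
      {e : Set (ZMod (2 * (3 ^ (m - 1) + 2 * n - 1))) // ∃ j, IsFedge m n j e} :=
    fun p => ⟨faceEdge m n p, p.1, p.2, rfl⟩
  have hfib : ∀ e, Nat.card {p // f p = e} = 2 := by
    rintro ⟨_, j, t, rfl⟩
    have hset : {p | f p = ⟨faceEdge m n (j, t), j, t, rfl⟩} =
        {(j, t), (j + partnerShift m n t, ⟨partner m t, partner_lt t.2⟩)} := by
      ext q
      exact Subtype.ext_iff.trans (faceEdge_eq_iff hm (j, t) q)
    change Nat.card ({p | f p = ⟨faceEdge m n (j, t), j, t, rfl⟩} : Set _) = 2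
    rw [hset, Nat.card_coe_set_eq, Set.ncard_pair]
    intro h
    exact partnerShift_ne_zero hm t.2 (by simpa using congrArg Prod.fst h)
  have hcard := Nat.card_congr (Equiv.sigmaFiberEquiv f)
  have := Fintype.ofFinite
    {e : Set (ZMod (2 * (3 ^ (m - 1) + 2 * n - 1))) // ∃ j, IsFedge m n j e}
  rw [Nat.card_sigma, Nat.card_prod, Nat.card_zmod, Nat.card_fin] at hcard
  simp only [hfib, Finset.sum_const, Finset.card_univ, smul_eq_mul] at hcard
  rw [Nat.card_eq_fintype_card, mul_comm, ← hcard]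

/-- for `m ≥ 3`, `n ≥ 0`, `N = 2(3^{m-1}+2n-1)`: every edge of a face `F_i`
is an edge of exactly two faces `F_j`; the number of distinct edges is
`(3^{m-1}+2n-1)(2m-1)`; and the Euler characteristic `f_0 - f_1 + f_2` (with `f_0 = f_2 = N`)
equals `(3^{m-1}+2n-1)(5-2m)`. -/
theorem Fface_edges_and_euler (m n : ℕ) (hm : 3 ≤ m) :
    (∀ e : Set (ZMod (2 * (3 ^ (m - 1) + 2 * n - 1))),
      (∃ j, IsFedge m n j e) →
      Nat.card {j : ZMod (2 * (3 ^ (m - 1) + 2 * n - 1)) // IsFedge m n j e} = 2) ∧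
    Nat.card {e : Set (ZMod (2 * (3 ^ (m - 1) + 2 * n - 1))) // ∃ j, IsFedge m n j e} =
      (3 ^ (m - 1) + 2 * n - 1) * (2 * m - 1) ∧
    ((2 * (3 ^ (m - 1) + 2 * n - 1) : ℕ) : ℤ) -
        (Nat.card {e : Set (ZMod (2 * (3 ^ (m - 1) + 2 * n - 1))) // ∃ j, IsFedge m n j e} : ℤ) +
        ((2 * (3 ^ (m - 1) + 2 * n - 1) : ℕ) : ℤ) =
      ((3 : ℤ) ^ (m - 1) + 2 * (n : ℤ) - 1) * (5 - 2 * (m : ℤ)) := by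
  have hcard : Nat.card {e : Set (ZMod (2 * (3 ^ (m - 1) + 2 * n - 1))) // ∃ j, IsFedge m n j e} =
      (3 ^ (m - 1) + 2 * n - 1) * (2 * m - 1) := by
    have := two_mul_card_edges (n := n) hm
    rw [mul_assoc] at this
    exact Nat.eq_of_mul_eq_mul_left two_pos this
  refine ⟨card_isFedge hm, hcard, ?_⟩
  have h1 : 1 ≤ 3 ^ (m - 1) := Nat.one_le_pow _ _ (by norm_num)
  rw [hcard]
  push_cast [Nat.cast_sub (show 1 ≤ 3 ^ (m - 1) + 2 * n by omega),
    Nat.cast_sub (show 1 ≤ 2 * m by omega)]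
  ring
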